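/- arXiv:1209.4795 — 3 statements merged into one kernel-verified Lean document; each statement's English description precedes it below -/
import Mathlib

section
/- (The general Octagrammum Mysticum) Let A, B, C, D, E, F, G, H be eight distinct points of ℙ²(ℂ) lying on an irreducible conic 𝒞. Let 𝒬₁ and 𝒬₂ be two quartics, given by homogeneous degree-4 polynomials with no common nonconstant factor, each passing through all eight points, and suppose their common zero set consists of exactly sixteen distinct points: the eight given points together with eight further points L, M, N, O, P, Q, R, S. Then these eight further points lie on a common conic, i.e. some nonzero homogeneous polynomial of degree 2 vanishes at all of L, M, N, O, P, Q, R, S. -/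
open MvPolynomial

noncomputable section

/-- Polynomials in three variables over `ℂ`. -/
abbrev Poly3 : Type := MvPolynomial (Fin 3) ℂ

/-- The complex projective plane `ℙ²(ℂ)`, the projectivization of `ℂ³`. -/
abbrev ProjPlane : Type := Projectivization ℂ (Fin 3 → ℂ)

/-- A (homogeneous) polynomial vanishes at a projective point if it vanishes at its
canonical nonzero representative vector (for homogeneous polynomials this is equivalent
to vanishing at any nonzero representative vector). -/
def VanishesAt (F : Poly3) (p : ProjPlane) : Prop :=
  MvPolynomial.eval p.rep F = 0

/-- The set of points of `ℙ²(ℂ)` at which `F` vanishes. -/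
def zeroSet (F : Poly3) : Set ProjPlane := {p | VanishesAt F p}

/-- Two defining polynomials give the same curve iff they are proportional by a
nonzero scalar. -/
def ProportionalTo (F G : Poly3) : Prop := ∃ c : ℂ, c ≠ 0 ∧ G = c • F

/-- A set of points is collinear if some nonzero homogeneous polynomial of degree 1
vanishes at all of them. -/
def Collin (s : Set ProjPlane) : Prop :=
  ∃ L : Poly3, L ≠ 0 ∧ L.IsHomogeneous 1 ∧ ∀ p ∈ s, VanishesAt L p

/-- No three distinct points of `s` are collinear. -/
def NoThreeCollinear (s : Set ProjPlane) : Prop :=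
  ∀ p q r, p ∈ s → q ∈ s → r ∈ s → p ≠ q → p ≠ r → q ≠ r → ¬ Collin {p, q, r}

/-- `L` is a (the) line through the points `p` and `q`. -/
def IsLineThrough (L : Poly3) (p q : ProjPlane) : Prop :=
  L ≠ 0 ∧ L.IsHomogeneous 1 ∧ VanishesAt L p ∧ VanishesAt L q

/-- `L` is the generalized Pascal line of the cubics `D₁` and `D₂` with respect to six
points `A, …, F`: the cubics have no common nonconstant factor, their common zero set
consists of exactly nine distinct points (the six given ones plus three further points),
and `L` is the line through the three further intersection points. -/
def IsGenPascalLine (A B C D E F : ProjPlane) (D₁ D₂ L : Poly3) : Prop :=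
  IsRelPrime D₁ D₂ ∧ L ≠ 0 ∧ L.IsHomogeneous 1 ∧
    ∃ P Q R : ProjPlane,
      ([A, B, C, D, E, F, P, Q, R] : List ProjPlane).Pairwise (· ≠ ·) ∧
      zeroSet D₁ ∩ zeroSet D₂ = {A, B, C, D, E, F, P, Q, R} ∧
      VanishesAt L P ∧ VanishesAt L Q ∧ VanishesAt L R



theorem dvd_of_forall_eval_eq_zero {P F : Poly3} (hP : Irreducible P)
    (h : ∀ v, eval v P = 0 → eval v F = 0) : P ∣ F := by
  have : (Ideal.span {P}).IsPrime := (Ideal.span_singleton_prime hP.ne_zero).2 hP.prime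
  rw [← Ideal.mem_span_singleton,
    ← IsPrime.vanishingIdeal_zeroLocus (K := ℂ) (Ideal.span {P})]
  intro v hv
  simpa [aeval_eq_eval] using
    h v (by simpa [aeval_eq_eval] using hv P (Ideal.mem_span_singleton_self P))

theorem MvPolynomial.IsHomogeneous.eval_smul {F : Poly3} {n : ℕ} (hF : F.IsHomogeneous n)
    (c : ℂ) (v : Fin 3 → ℂ) : eval (c • v) F = c ^ n * eval v F := by
  rw [eval_eq, eval_eq, Finset.mul_sum]
  refine Finset.sum_congr rfl fun d hd => ?_
  simp only [Pi.smul_apply, smul_eq_mul, mul_pow, Finset.prod_mul_distrib,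
    Finset.prod_pow_eq_pow_sum]
  rw [← hF.degree_eq_sum_deg_support hd]
  ring

theorem exists_isHomogeneous_eq_mul {K G : Poly3} {m n : ℕ} (hK : K.IsHomogeneous m)
    (hG : G.IsHomogeneous (m + n)) (h : K ∣ G) :
    ∃ W : Poly3, W.IsHomogeneous n ∧ G = K * W := by
  obtain ⟨W, rfl⟩ := h
  refine ⟨homogeneousComponent n W, homogeneousComponent_isHomogeneous n W, ?_⟩
  let := gradedAlgebra (σ := Fin 3) (R := ℂ)
  have := DirectSum.coe_decompose_mul_of_left_mem_of_le (homogeneousSubmodule (Fin 3) ℂ) (b := W)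
    (n := m + n) hK (Nat.le_add_right m n)
  rw [DirectSum.decompose_of_mem _ hG, DirectSum.of_eq_same, Nat.add_sub_cancel_left] at this
  rwa [← decomposition.decompose'_apply]

theorem exists_eval_line_ne_zero {K : Poly3} (hK : K.IsHomogeneous 2) (hirr : Irreducible K)
    {a p : Fin 3 → ℂ} (hap : LinearIndependent ℂ ![a, p]) :
    ∃ s t : ℂ, eval (s • a + t • p) K ≠ 0 := by
  by_contra! h
  have hc := crossProduct_ne_zero_iff_linearIndependent.2 hap
  set c := crossProduct a p with hcdef
  set l : Poly3 := ∑ i, C (c i) * X i with hl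
  have hleval (v) : eval v l = v ⬝ᵥ c := by simp [hl, dotProduct, mul_comm]
  have hlhom : l.IsHomogeneous 1 := .sum _ _ _ fun i _ => isHomogeneous_C_mul_X _ _
  have hl0 : l ≠ 0 := by
    rintro h0
    refine hc (funext fun i => ?_)
    simpa [h0] using (hleval (Pi.single i 1)).symm
  have hldeg := hlhom.totalDegree hl0
  have hlirr : Irreducible l := by
    refine irreducible_of_totalDegree_eq_one hldeg fun x hx => ?_
    refine isUnit_iff_ne_zero.2 ?_
    rintro rfl
    exact hl0 (MvPolynomial.ext _ _ fun m => by simpa using hx m)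
  have hdvd : l ∣ K := by
    refine dvd_of_forall_eval_eq_zero hlirr fun v hv => ?_
    rw [hleval, hcdef, triple_product_eq_det] at hv
    have hv' : ¬ LinearIndependent ℂ ![v, a, p] := by
      intro hli
      have := (Matrix.linearIndependent_rows_iff_isUnit (A := ![v, a, p])).1 hli
      exact (Matrix.isUnit_iff_isUnit_det _ |>.1 this).ne_zero hv
    have hspan : v ∈ Submodule.span ℂ (Set.range ![a, p]) := by
      by_contra hn
      exact hv' (linearIndependent_finCons.2 ⟨hap, hn⟩)
    simp only [Matrix.range_cons, Matrix.range_empty, Set.union_empty, Set.singleton_union,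
      Submodule.mem_span_pair] at hspan
    obtain ⟨s, t, rfl⟩ := hspan
    exact h s t
  obtain ⟨u, rfl⟩ := hdvd
  have hu : IsUnit u := (hirr.isUnit_or_isUnit rfl).resolve_left hlirr.not_isUnit
  have hu0 := (isUnit_iff_totalDegree_of_isReduced.1 hu).2
  have := hK.totalDegree hirr.ne_zero
  rw [totalDegree_mul_of_isDomain hl0 hu.ne_zero, hldeg, hu0] at this
  omega

theorem MvPolynomial.IsHomogeneous.exists_bilinForm {K : Poly3} (hK : K.IsHomogeneous 2) :
    ∃ B : LinearMap.BilinForm ℂ (Fin 3 → ℂ), (∀ u v, B u v = B v u) ∧ ∀ v, eval v K = B v v := by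
  rw [← mem_homogeneousSubmodule, ← homogeneousSubmodule_one_pow, pow_two,
    homogeneousSubmodule_one_eq_span_X, Submodule.span_mul_span] at hK
  induction hK using Submodule.span_induction with
  | mem F hF =>
    obtain ⟨_, ⟨i, rfl⟩, _, ⟨j, rfl⟩, rfl⟩ := hF
    let p (i : Fin 3) : Module.Dual ℂ (Fin 3 → ℂ) := LinearMap.proj i
    refine ⟨(1 / 2 : ℂ) • ((p i).smulRight (p j) + (p j).smulRight (p i)),
      fun u v => ?_, fun v => ?_⟩
    · simp [p]; ring
    · simp [p]; ring
  | zero => exact ⟨0, by simp, by simp⟩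
  | add F G _ _ hF hG =>
    obtain ⟨B, hB, hB'⟩ := hF
    obtain ⟨B', hB₂, hB₂'⟩ := hG
    exact ⟨B + B', fun u v => by simp [hB u v, hB₂ u v], fun v => by simp [hB', hB₂']⟩
  | smul c F _ hF =>
    obtain ⟨B, hB, hB'⟩ := hF
    exact ⟨c • B, fun u v => by simp [hB u v], fun v => by simp [hB', smul_eval]⟩

theorem vanishesAt_mk {F : Poly3} {n : ℕ} (hF : F.IsHomogeneous n) {v : Fin 3 → ℂ} (hv : v ≠ 0) :
    VanishesAt F (Projectivization.mk ℂ v hv) ↔ eval v F = 0 := by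
  obtain ⟨c, hc⟩ := Projectivization.exists_smul_eq_mk_rep ℂ v hv
  rw [VanishesAt, ← hc, Units.smul_def, hF.eval_smul]
  simp

theorem exists_normal_form {K : Poly3} (hK : K.IsHomogeneous 2) (hirr : Irreducible K)
    {a p : Fin 3 → ℂ} (hap : LinearIndependent ℂ ![a, p]) (ha : eval a K = 0)
    (hp : eval p K = 0) :
    ∃ (e : Fin 3 → ℂ) (β δ : ℂ), LinearIndependent ℂ ![a, p, e] ∧ β ≠ 0 ∧ δ ≠ 0 ∧
      ∀ x y z : ℂ, eval (x • a + y • p + z • e) K = β * (x * y - δ * z ^ 2) := by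
  obtain ⟨B, hB, hKB⟩ := hK.exists_bilinForm
  have haa : B a a = 0 := by rw [← hKB, ha]
  have hpp : B p p = 0 := by rw [← hKB, hp]
  have hβ : B a p ≠ 0 := by
    obtain ⟨s, t, hst⟩ := exists_eval_line_ne_zero hK hirr hap
    intro h
    simp [hKB, haa, hpp, h, hB p a] at hst
  obtain ⟨w, hw⟩ := exists_linearIndependent_cons_of_lt_finrank hap (by simp)
  set e := w - (B a w / B a p) • p - (B p w / B a p) • a with he
  have hae : B a e = 0 := by simp [he, haa]; field_simp; ring
  have hpe : B p e = 0 := by simp [he, hpp, hB p a]; field_simp; ring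
  have hli : LinearIndependent ℂ ![a, p, e] := by
    rw [Fintype.linearIndependent_iff] at hw ⊢
    intro g hg
    have := hw ![g 2, g 0 - g 2 * (B p w / B a p), g 1 - g 2 * (B a w / B a p)] (by
      rw [← hg]
      simp [Fin.sum_univ_three, he]
      module)
    simp only [Fin.forall_fin_succ] at this ⊢
    simp at this ⊢
    obtain ⟨h2, h0, h1⟩ := this
    simp_all
  have hee : B e e ≠ 0 := by
    have hli' : LinearIndependent ℂ ![a, e] := by
      convert hli.comp ![0, 2] (by decide) using 1
      ext i; fin_cases i <;> rfl
    obtain ⟨s, t, hst⟩ := exists_eval_line_ne_zero hK hirr hli'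
    intro h
    simp [hKB, haa, hae, h, hB e a] at hst
  refine ⟨e, 2 * B a p, - B e e / (2 * B a p), hli, by simpa, by simp [hee, hβ], fun x y z => ?_⟩
  simp [hKB, haa, hpp, hae, hpe, hB e a, hB e p, hB p a]
  field_simp
  ring

theorem exists_parametrization {K : Poly3} (hK : K.IsHomogeneous 2) (hirr : Irreducible K)
    {a p : ProjPlane} (hap : a ≠ p) (ha : a ∈ zeroSet K) (hp : p ∈ zeroSet K) :
    ∃ (ψ : Fin 3 → Polynomial ℂ) (f : ℂ → ProjPlane), (∀ i, (ψ i).natDegree ≤ 2) ∧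
      f.Injective ∧ Set.range f = zeroSet K \ {a} ∧
      ∀ (F : Poly3) (n : ℕ), F.IsHomogeneous n →
        ∀ s, f s ∈ zeroSet F ↔ (aeval ψ F).eval s = 0 := by
  have hli₂ : LinearIndependent ℂ ![a.rep, p.rep] := by
    have h := Projectivization.independent_iff.1
      ((Projectivization.independent_pair_iff_ne a p).2 hap)
    rwa [show Projectivization.rep ∘ ![a, p] = ![a.rep, p.rep] by
      ext i; fin_cases i <;> rfl] at h
  obtain ⟨e, β, δ, hli, hβ, hδ, hnf⟩ := exists_normal_form hK hirr hli₂ ha hp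
  have hzero : ∀ x y z : ℂ, x • a.rep + y • p.rep + z • e = 0 → x = 0 ∧ y = 0 ∧ z = 0 := by
    intro x y z h
    have := Fintype.linearIndependent_iff.1 hli ![x, y, z] (by simpa [Fin.sum_univ_three] using h)
    exact ⟨this 0, this 1, this 2⟩
  have hspan : ∀ v : Fin 3 → ℂ, ∃ x y z : ℂ, x • a.rep + y • p.rep + z • e = v := by
    intro v
    have hv : v ∈ Submodule.span ℂ (Set.range ![a.rep, p.rep, e]) := by
      rw [hli.span_eq_top_of_card_eq_finrank (by simp)]
      trivial
    obtain ⟨c, hc⟩ := (Submodule.mem_span_range_iff_exists_fun ℂ).1 hv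
    exact ⟨c 0, c 1, c 2, by simpa [Fin.sum_univ_three] using hc⟩
  let v (s : ℂ) : Fin 3 → ℂ := (δ * s ^ 2) • a.rep + (1 : ℂ) • p.rep + s • e
  have hv0 (s : ℂ) : v s ≠ 0 := fun h => one_ne_zero (hzero _ _ _ h).2.1
  let ψ (i : Fin 3) : Polynomial ℂ :=
    .C (δ * a.rep i) * .X ^ 2 + .C (e i) * .X + .C (p.rep i)
  refine ⟨ψ, fun s => Projectivization.mk ℂ (v s) (hv0 s),
    fun i => Polynomial.natDegree_quadratic_le,
    fun s t hst => ?_, ?_, fun F n hF s => ?_⟩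
  · obtain ⟨c, hc⟩ := (Projectivization.mk_eq_mk_iff' ℂ _ _ _ _).1 hst
    have := hzero (c * (δ * t ^ 2) - δ * s ^ 2) (c - 1) (c * t - s) (by
      rw [← sub_eq_zero.2 hc]
      simp only [v]
      module)
    obtain ⟨-, h1, h2⟩ := this
    rw [sub_eq_zero.1 h1, one_mul] at h2
    exact (sub_eq_zero.1 h2).symm
  · ext r
    constructor
    · rintro ⟨s, rfl⟩
      refine ⟨(vanishesAt_mk hK _).2 ?_, fun h => ?_⟩
      · simp only [v, hnf]
        ring
      · rw [Set.mem_singleton_iff, ← a.mk_rep, Projectivization.mk_eq_mk_iff'] at h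
        obtain ⟨c, hc⟩ := h
        have := hzero (δ * s ^ 2 - c) 1 s (by
          rw [← sub_eq_zero.2 hc.symm]
          simp only [v]
          module)
        exact one_ne_zero this.2.1
    · rintro ⟨hr, hra⟩
      obtain ⟨x, y, z, hxyz⟩ := hspan r.rep
      have hr' : eval r.rep K = 0 := hr
      rw [← hxyz, hnf, mul_eq_zero, or_iff_right hβ, sub_eq_zero] at hr'
      have hy : y ≠ 0 := by
        rintro rfl
        have hz : z = 0 := by simpa [hδ] using hr'.symm
        refine hra ?_
        rw [Set.mem_singleton_iff, ← a.mk_rep, ← r.mk_rep, Projectivization.mk_eq_mk_iff']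
        exact ⟨x, by simp [← hxyz, hz]⟩
      refine ⟨z / y, ?_⟩
      dsimp only
      rw [← r.mk_rep, Projectivization.mk_eq_mk_iff']
      refine ⟨y⁻¹, ?_⟩
      have hx : x = δ * z ^ 2 / y := by field_simp; exact hr'
      have h₁ : y⁻¹ * x = δ * (z / y) ^ 2 := by rw [hx]; field_simp
      rw [← hxyz, smul_add, smul_add, smul_smul, smul_smul, smul_smul, h₁, inv_mul_cancel₀ hy,
        inv_mul_eq_div]
  · refine (vanishesAt_mk hF _).trans ?_
    have : (aeval ψ F).eval s = eval (v s) F := by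
      rw [← Polynomial.coe_evalRingHom, map_aeval, coe_eval₂Hom, eval, coe_eval₂Hom]
      congr 1
      · ext; simp
      · ext i
        simp [ψ, v]
        ring
    rw [this]

theorem zeroSet_diff_subset {K F : Poly3} (hK : K.IsHomogeneous 2) (hirr : Irreducible K) {n : ℕ}
    (hF : F.IsHomogeneous n) {a : ProjPlane} (ha : a ∈ zeroSet K) {T : Finset ProjPlane}
    (hT : ↑T ⊆ zeroSet K ∩ zeroSet F) (haT : a ∉ T) (hcard : n * 2 < T.card) :
    zeroSet K \ {a} ⊆ zeroSet F := by
  classical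
  obtain ⟨p, hpT⟩ := Finset.card_pos.1 (by omega : 0 < T.card)
  obtain ⟨ψ, f, hψ, hf, hrange, hzero⟩ := exists_parametrization hK hirr
    (by rintro rfl; exact haT hpT) ha (hT hpT).1
  have hg : aeval ψ F = 0 := by
    by_contra hne
    have hsub : T.preimage f hf.injOn ⊆ (aeval ψ F).roots.toFinset := by
      intro s hs
      rw [Finset.mem_preimage] at hs
      simpa [hne, Polynomial.IsRoot] using (hzero F n hF s).1 (hT hs).2
    have hle := (Finset.card_le_card hsub).trans ((Multiset.toFinset_card_le _).trans
      ((Polynomial.card_roots' _).trans (aeval_natDegree_le F hF.totalDegree_le ψ hψ)))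
    rw [← Finset.card_image_of_injective _ hf, Finset.image_preimage,
      Finset.filter_true_of_mem] at hle
    · omega
    · intro q hq
      rw [hrange]
      exact ⟨(hT hq).1, by rintro rfl; exact haT hq⟩
  rw [← hrange]
  rintro _ ⟨s, rfl⟩
  simp [hzero F n hF s, hg]

theorem infinite_zeroSet {K : Poly3} (hK : K.IsHomogeneous 2) (hirr : Irreducible K)
    {a p : ProjPlane} (hap : a ≠ p) (ha : a ∈ zeroSet K) (hp : p ∈ zeroSet K) :
    (zeroSet K).Infinite := by
  obtain ⟨-, f, -, hf, hrange, -⟩ := exists_parametrization hK hirr hap ha hp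
  exact ((Set.infinite_range_of_injective hf).mono hrange.subset).mono Set.sdiff_subset

theorem dvd_of_card_lt {K F : Poly3} (hK : K.IsHomogeneous 2) (hirr : Irreducible K) {n : ℕ}
    (hn : n ≠ 0) (hF : F.IsHomogeneous n) {T : Finset ProjPlane}
    (hT : ↑T ⊆ zeroSet K ∩ zeroSet F) (hcard : n * 2 < T.card) : K ∣ F := by
  classical
  obtain ⟨a, ha, p, hp, hap⟩ := Finset.one_lt_card.1 (by omega : 1 < T.card)
  have hinf := infinite_zeroSet hK hirr hap (hT ha).1 (hT hp).1
  obtain ⟨b, hb, hbT⟩ := hinf.exists_notMem_finset T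
  obtain ⟨c, hc, hcT⟩ := hinf.exists_notMem_finset (insert b T)
  rw [Finset.mem_insert, not_or] at hcT
  refine dvd_of_forall_eval_eq_zero hirr fun v hv => ?_
  obtain rfl | hv0 := eq_or_ne v 0
  · simpa [hn] using hF.eval_smul 0 0
  rw [← vanishesAt_mk hK hv0] at hv
  rw [← vanishesAt_mk hF hv0]
  by_cases h : Projectivization.mk ℂ v hv0 = b
  · exact zeroSet_diff_subset hK hirr hF hc hT hcT.2 hcard ⟨hv, by rw [h]; exact Ne.symm hcT.1⟩
  · exact zeroSet_diff_subset hK hirr hF hb hT hbT hcard ⟨hv, h⟩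

/-- If two relatively prime quartics share eight points with an irreducible conic, then some conic
contains all their common points other than these eight. -/
theorem exists_residual_conic {K Q₁ Q₂ : Poly3} (hK : K.IsHomogeneous 2) (hirr : Irreducible K)
    (h₁ : Q₁.IsHomogeneous 4) (h₂ : Q₂.IsHomogeneous 4) (hrel : IsRelPrime Q₁ Q₂)
    {T : Finset ProjPlane} (hT : T.card = 8) (hTK : ↑T ⊆ zeroSet K)
    (hTQ : ↑T ⊆ zeroSet Q₁ ∩ zeroSet Q₂) :
    ∃ W : Poly3, W ≠ 0 ∧ W.IsHomogeneous 2 ∧ (zeroSet Q₁ ∩ zeroSet Q₂) \ T ⊆ zeroSet W := by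
  classical
  have hndvd : ¬ (K ∣ Q₁ ∧ K ∣ Q₂) := fun h => hirr.not_isUnit (hrel h.1 h.2)
  have hninth {F : Poly3} (hF : F.IsHomogeneous 4) (hTF : ↑T ⊆ zeroSet F) {x : ProjPlane}
      (hxT : x ∉ T) (hxK : x ∈ zeroSet K) (hxF : x ∈ zeroSet F) : K ∣ F := by
    refine dvd_of_card_lt hK hirr (by norm_num) hF (T := insert x T) ?_ (by simp [hxT, hT])
    rw [Finset.coe_insert, Set.insert_subset_iff]
    exact ⟨⟨hxK, hxF⟩, Set.subset_inter hTK hTF⟩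
  obtain ⟨a, ha, p, hp, hap⟩ := Finset.one_lt_card.1 (by omega : 1 < T.card)
  obtain ⟨x, hxK, hxT⟩ := (infinite_zeroSet hK hirr hap (hTK ha) (hTK hp)).exists_notMem_finset T
  set c₁ := eval x.rep Q₂
  set c₂ := eval x.rep Q₁
  have hc : ¬ (c₁ = 0 ∧ c₂ = 0) := fun h => hndvd
    ⟨hninth h₁ (fun _ h => (hTQ h).1) hxT hxK h.2, hninth h₂ (fun _ h => (hTQ h).2) hxT hxK h.1⟩
  set G : Poly3 := C c₁ * Q₁ - C c₂ * Q₂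
  have hGhom : G.IsHomogeneous 4 := (h₁.C_mul _).sub (h₂.C_mul _)
  have hG {q : ProjPlane} (hq : q ∈ zeroSet Q₁ ∩ zeroSet Q₂) : eval q.rep G = 0 := by
    have hq₁ : eval q.rep Q₁ = 0 := hq.1
    have hq₂ : eval q.rep Q₂ = 0 := hq.2
    simp [G, hq₁, hq₂]
  have hKG : K ∣ G := hninth hGhom (fun q hq => hG (hTQ hq)) hxT hxK
    (show eval x.rep G = 0 by simp [G, c₁, c₂, mul_comm])
  obtain ⟨W, hW, hGW⟩ := exists_isHomogeneous_eq_mul (n := 2) hK hGhom hKG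
  refine ⟨W, ?_, hW, fun q hq => ?_⟩
  · rintro rfl
    have heq : C c₁ * Q₁ = C c₂ * Q₂ := sub_eq_zero.1 (by simpa using hGW)
    have hfalse {F : Poly3} (hF : eval a.rep F = 0) (hF₁ : F ∣ Q₁) (hF₂ : F ∣ Q₂) : False :=
      ((hrel hF₁ hF₂).map (eval a.rep)).ne_zero hF
    have hunit {c : ℂ} (hc : c ≠ 0) : IsUnit (C c : Poly3) := (isUnit_iff_ne_zero.2 hc).map C
    by_cases h : c₁ = 0
    · exact hfalse (hTQ ha).1 dvd_rfl
        ((hunit fun h' => hc ⟨h, h'⟩).dvd_mul_left.1 (heq ▸ dvd_mul_left _ _))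
    · exact hfalse (hTQ ha).2 ((hunit h).dvd_mul_left.1 (heq ▸ dvd_mul_left _ _)) dvd_rfl
  · have h := hG hq.1
    rw [hGW, map_mul, mul_eq_zero] at h
    refine h.resolve_left fun hqK => hndvd ⟨?_, ?_⟩
    · exact hninth h₁ (fun _ h => (hTQ h).1) hq.2 hqK hq.1.1
    · exact hninth h₂ (fun _ h => (hTQ h).2) hq.2 hqK hq.1.2

/-- **The general Octagrammum Mysticum.** If two quartics with no common nonconstant
factor pass through eight distinct points on an irreducible conic and meet in exactly
sixteen distinct points (the eight given ones plus `L,M,N,O,P,Q,R,S`), then the eight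
further points lie on a common conic. -/
theorem general_octagrammum_mysticum (A B C D E F G H L M N O P Q R S : ProjPlane)
    (hdist : ([A, B, C, D, E, F, G, H, L, M, N, O, P, Q, R, S] :
      List ProjPlane).Pairwise (· ≠ ·))
    (K : Poly3) (hKh : K.IsHomogeneous 2) (hKirr : Irreducible K)
    (honK : ∀ p ∈ [A, B, C, D, E, F, G, H], VanishesAt K p)
    (Q₁ Q₂ : Poly3) (h1 : Q₁ ≠ 0) (h2 : Q₂ ≠ 0)
    (h1h : Q₁.IsHomogeneous 4) (h2h : Q₂.IsHomogeneous 4)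
    (hrel : IsRelPrime Q₁ Q₂)
    (hon1 : ∀ p ∈ [A, B, C, D, E, F, G, H], VanishesAt Q₁ p)
    (hon2 : ∀ p ∈ [A, B, C, D, E, F, G, H], VanishesAt Q₂ p)
    (hzero : zeroSet Q₁ ∩ zeroSet Q₂ =
      {A, B, C, D, E, F, G, H, L, M, N, O, P, Q, R, S}) :
    ∃ W : Poly3, W ≠ 0 ∧ W.IsHomogeneous 2 ∧
      ∀ p ∈ [L, M, N, O, P, Q, R, S], VanishesAt W p := by
  classical
  have hnodup : ([A, B, C, D, E, F, G, H] ++ [L, M, N, O, P, Q, R, S]).Nodup := hdist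
  obtain ⟨W, hW0, hW, hsub⟩ := exists_residual_conic hKh hKirr h1h h2h hrel
    (T := [A, B, C, D, E, F, G, H].toFinset)
    (List.toFinset_card_of_nodup hnodup.of_append_left)
    (fun p hp => honK p (List.mem_toFinset.1 hp))
    (fun p hp => ⟨hon1 p (List.mem_toFinset.1 hp), hon2 p (List.mem_toFinset.1 hp)⟩)
  refine ⟨W, hW0, hW, fun p hp => hsub ⟨?_, fun hp' => ?_⟩⟩
  · rw [hzero]
    simp only [List.mem_cons, List.not_mem_nil, or_false] at hp
    simp only [Set.mem_insert_iff, Set.mem_singleton_iff]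
    iterate 8 right
    exact hp
  · exact List.disjoint_of_nodup_append hnodup (List.mem_toFinset.1 hp') hp
end
end

section
/- (The classical Octagrammum Mysticum) Let A, B, C, D, E, F, G, H be eight distinct points of ℙ²(ℂ) on an irreducible conic, no three collinear, and suppose all sixteen intersection points of a line from {l(AB), l(CD), l(EF), l(GH)} with a line from {l(BC), l(DE), l(FG), l(HA)} are distinct. Then the eight points l(AB) ∩ l(DE), l(AB) ∩ l(FG), l(CD) ∩ l(FG), l(CD) ∩ l(HA), l(EF) ∩ l(HA), l(EF) ∩ l(BC), l(GH) ∩ l(BC), l(GH) ∩ l(DE) lie on a common conic, i.e. some nonzero homogeneous polynomial of degree 2 vanishes at all eight of them. -/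
open MvPolynomial

noncomputable section

/-- Three vectors of `ℂ³` on which no nonzero linear form vanishes simultaneously. -/
def InGeneralPosition (a b c : Fin 3 → ℂ) : Prop :=
  ∀ L : Poly3, L ≠ 0 → L.IsHomogeneous 1 → eval a L = 0 → eval b L = 0 → eval c L ≠ 0

theorem InGeneralPosition.rotate {a b c : Fin 3 → ℂ} (h : InGeneralPosition a b c) :
    InGeneralPosition b c a :=
  fun L h0 h1 hb hc ha => h L h0 h1 ha hb hc

theorem InGeneralPosition.swap {a b c : Fin 3 → ℂ} (h : InGeneralPosition a b c) :
    InGeneralPosition b a c :=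
  fun L h0 h1 hb ha => h L h0 h1 ha hb

theorem exists_eval_eq_of_isHomogeneous_one {L : Poly3} (hL : L.IsHomogeneous 1) :
    ∃ l : Fin 3 → ℂ, ∀ v : Fin 3 → ℂ, eval v L = l 0 * v 0 + l 1 * v 1 + l 2 * v 2 := by
  suffices h : ∀ s : Finset (Fin 3 →₀ ℕ), (∀ d ∈ s, d.degree = 1) → ∃ l : Fin 3 → ℂ,
      ∀ v : Fin 3 → ℂ, ∑ d ∈ s, L.coeff d * ∏ i, v i ^ d i =
        l 0 * v 0 + l 1 * v 1 + l 2 * v 2 by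
    obtain ⟨l, hl⟩ := h L.support fun d hd => by
      rw [Finsupp.degree_eq_weight_one]; exact hL (mem_support_iff.1 hd)
    exact ⟨l, fun v => by rw [eval_eq', hl]⟩
  intro s
  induction s using Finset.induction_on with
  | empty => exact fun _ => ⟨0, by simp⟩
  | insert d s hd ih =>
    intro h
    obtain ⟨l, hl⟩ := ih fun e he => h e (Finset.mem_insert_of_mem he)
    have hdeg := h d (Finset.mem_insert_self d s)
    rw [Finsupp.degree_eq_sum, Fin.sum_univ_three] at hdeg
    refine ⟨fun i => l i + L.coeff d * d i, fun v => ?_⟩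
    rw [Finset.sum_insert hd, hl, Fin.prod_univ_three]
    have : (d 0 = 1 ∧ d 1 = 0 ∧ d 2 = 0) ∨ (d 0 = 0 ∧ d 1 = 1 ∧ d 2 = 0) ∨
        (d 0 = 0 ∧ d 1 = 0 ∧ d 2 = 1) := by omega
    rcases this with ⟨h0, h1, h2⟩ | ⟨h0, h1, h2⟩ | ⟨h0, h1, h2⟩ <;>
      simp only [h0, h1, h2] <;> push_cast <;> ring

theorem exists_eval_eq_of_isHomogeneous_two {K : Poly3} (hK : K.IsHomogeneous 2) :
    ∃ q r : Fin 3 → ℂ, ∀ v : Fin 3 → ℂ, eval v K =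
      q 0 * v 0 ^ 2 + q 1 * v 1 ^ 2 + q 2 * v 2 ^ 2 +
        r 0 * (v 1 * v 2) + r 1 * (v 0 * v 2) + r 2 * (v 0 * v 1) := by
  suffices h : ∀ s : Finset (Fin 3 →₀ ℕ), (∀ d ∈ s, d.degree = 2) → ∃ q r : Fin 3 → ℂ,
      ∀ v : Fin 3 → ℂ, ∑ d ∈ s, K.coeff d * ∏ i, v i ^ d i =
        q 0 * v 0 ^ 2 + q 1 * v 1 ^ 2 + q 2 * v 2 ^ 2 +
          r 0 * (v 1 * v 2) + r 1 * (v 0 * v 2) + r 2 * (v 0 * v 1) by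
    obtain ⟨q, r, hqr⟩ := h K.support fun d hd => by
      rw [Finsupp.degree_eq_weight_one]; exact hK (mem_support_iff.1 hd)
    exact ⟨q, r, fun v => by rw [eval_eq', hqr]⟩
  intro s
  induction s using Finset.induction_on with
  | empty => exact fun _ => ⟨0, 0, by simp⟩
  | insert d s hd ih =>
    intro h
    obtain ⟨q, r, hqr⟩ := ih fun e he => h e (Finset.mem_insert_of_mem he)
    have hdeg := h d (Finset.mem_insert_self d s)
    rw [Finsupp.degree_eq_sum, Fin.sum_univ_three] at hdeg
    refine ⟨fun i => q i + K.coeff d * (if d i = 2 then 1 else 0),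
      fun i => r i + K.coeff d * (if d i = 0 ∧ ∀ j, d j ≠ 2 then 1 else 0), fun v => ?_⟩
    rw [Finset.sum_insert hd, hqr, Fin.prod_univ_three]
    have : (d 0 = 2 ∧ d 1 = 0 ∧ d 2 = 0) ∨ (d 0 = 0 ∧ d 1 = 2 ∧ d 2 = 0) ∨
        (d 0 = 0 ∧ d 1 = 0 ∧ d 2 = 2) ∨ (d 0 = 0 ∧ d 1 = 1 ∧ d 2 = 1) ∨
        (d 0 = 1 ∧ d 1 = 0 ∧ d 2 = 1) ∨ (d 0 = 1 ∧ d 1 = 1 ∧ d 2 = 0) := by omega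
    rcases this with ⟨h0, h1, h2⟩ | ⟨h0, h1, h2⟩ | ⟨h0, h1, h2⟩ | ⟨h0, h1, h2⟩ |
        ⟨h0, h1, h2⟩ | ⟨h0, h1, h2⟩ <;>
      simp [h0, h1, h2, Fin.forall_fin_succ] <;> ring

theorem eval_combination_of_isHomogeneous_one {L : Poly3} (hL : L.IsHomogeneous 1)
    (a b c : Fin 3 → ℂ) (x y z : ℂ) :
    eval (x • a + y • b + z • c) L = x * eval a L + y * eval b L + z * eval c L := by
  obtain ⟨l, hl⟩ := exists_eval_eq_of_isHomogeneous_one hL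
  simp only [hl, Pi.add_apply, Pi.smul_apply, smul_eq_mul]
  ring

theorem exists_eval_combination_of_isHomogeneous_two {K : Poly3} (hK : K.IsHomogeneous 2)
    (a b c : Fin 3 → ℂ) :
    ∃ k₁ k₂ k₃ : ℂ, ∀ x y z : ℂ, eval (x • a + y • b + z • c) K =
      x ^ 2 * eval a K + y ^ 2 * eval b K + z ^ 2 * eval c K +
        x * y * k₁ + y * z * k₂ + x * z * k₃ := by
  obtain ⟨q, r, h⟩ := exists_eval_eq_of_isHomogeneous_two hK
  refine ⟨eval (a + b) K - eval a K - eval b K, eval (b + c) K - eval b K - eval c K,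
    eval (a + c) K - eval a K - eval c K, fun x y z => ?_⟩
  simp only [h, Pi.add_apply, Pi.smul_apply, smul_eq_mul]
  ring

/-- Vectors with vanishing determinant lie on a common line. -/
theorem exists_line_of_det_eq_zero (a b c : Fin 3 → ℂ) (h : (Matrix.of ![a, b, c]).det = 0) :
    ∃ L : Poly3, L ≠ 0 ∧ L.IsHomogeneous 1 ∧ eval a L = 0 ∧ eval b L = 0 ∧ eval c L = 0 := by
  obtain ⟨l, hl0, hl⟩ := Matrix.exists_mulVec_eq_zero_iff.2 h
  have he : ∀ v : Fin 3 → ℂ, eval v (∑ i, C (l i) * X i : Poly3) = v ⬝ᵥ l := fun v => by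
    simp [dotProduct, Fin.sum_univ_three, mul_comm]
  refine ⟨∑ i, C (l i) * X i, fun h0 => hl0 ?_, ?_, ?_, ?_, ?_⟩
  · ext i
    have := he (Pi.single i 1)
    simpa [h0] using this.symm
  · exact IsHomogeneous.sum _ _ _ fun i _ => isHomogeneous_C_mul_X _ _
  · rw [he]; exact congrFun hl 0
  · rw [he]; exact congrFun hl 1
  · rw [he]; exact congrFun hl 2

theorem exists_line_through (a b : Fin 3 → ℂ) :
    ∃ L : Poly3, L ≠ 0 ∧ L.IsHomogeneous 1 ∧ eval a L = 0 ∧ eval b L = 0 := by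
  obtain ⟨L, h0, h1, ha, hb, -⟩ := exists_line_of_det_eq_zero a b b
    (Matrix.det_zero_of_row_eq (i := 1) (j := 2) (by decide) rfl)
  exact ⟨L, h0, h1, ha, hb⟩

theorem InGeneralPosition.exists_eq_combination {a b c : Fin 3 → ℂ}
    (h : InGeneralPosition a b c) (p : Fin 3 → ℂ) :
    ∃ x y z : ℂ, p = x • a + y • b + z • c := by
  have hdet : IsUnit (Matrix.of ![a, b, c]).det := isUnit_iff_ne_zero.2 fun h0 => by
    obtain ⟨L, hL, hL1, ha, hb, hc⟩ := exists_line_of_det_eq_zero a b c h0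
    exact h L hL hL1 ha hb hc
  obtain ⟨w, hw⟩ : ∃ w : Fin 3 → ℂ, Matrix.vecMul w (Matrix.of ![a, b, c]) = p :=
    ⟨Matrix.vecMul p (Matrix.of ![a, b, c])⁻¹, by
      rw [Matrix.vecMul_vecMul, Matrix.nonsing_inv_mul _ hdet, Matrix.vecMul_one]⟩
  refine ⟨w 0, w 1, w 2, ?_⟩
  rw [← hw]
  ext i
  simp [Matrix.vecMul, dotProduct, Fin.sum_univ_three]

theorem not_isUnit_of_eval_eq_zero {F : Poly3} {v : Fin 3 → ℂ} (h : eval v F = 0) :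
    ¬ IsUnit F :=
  fun hu => not_isUnit_zero (h ▸ hu.map (eval v))

/-- An irreducible conic through four points is a nondegenerate member of the pencil spanned
by two pairs of opposite sides of the quadrangle. -/
theorem exists_eq_pencil {K : Poly3} (hK : K.IsHomogeneous 2) (hirr : Irreducible K)
    {a b c d : Fin 3 → ℂ} (habc : InGeneralPosition a b c) (habd : InGeneralPosition a b d)
    (hacd : InGeneralPosition a c d) (hbcd : InGeneralPosition b c d)
    (ha : eval a K = 0) (hb : eval b K = 0) (hc : eval c K = 0) (hd : eval d K = 0)
    {LAB LBC LCD LDA : Poly3}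
    (hAB : LAB ≠ 0) (hAB1 : LAB.IsHomogeneous 1) (hABa : eval a LAB = 0) (hABb : eval b LAB = 0)
    (hBC : LBC ≠ 0) (hBC1 : LBC.IsHomogeneous 1) (hBCb : eval b LBC = 0) (hBCc : eval c LBC = 0)
    (hCD : LCD ≠ 0) (hCD1 : LCD.IsHomogeneous 1) (hCDc : eval c LCD = 0) (hCDd : eval d LCD = 0)
    (hDA : LDA ≠ 0) (hDA1 : LDA.IsHomogeneous 1) (hDAd : eval d LDA = 0)
    (hDAa : eval a LDA = 0) :
    ∃ u v : ℂ, u ≠ 0 ∧ v ≠ 0 ∧ K = C u * (LAB * LCD) + C v * (LBC * LDA) := by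
  suffices h : ∃ u v : ℂ, K = C u * (LAB * LCD) + C v * (LBC * LDA) by
    obtain ⟨u, v, h⟩ := h
    refine ⟨u, v, ?_, ?_, h⟩
    · rintro rfl
      rw [map_zero, zero_mul, zero_add, ← mul_assoc] at h
      rcases hirr.isUnit_or_isUnit h with hu | hu
      · exact not_isUnit_of_eval_eq_zero (v := b) (by simp [hBCb]) hu
      · exact not_isUnit_of_eval_eq_zero hDAa hu
    · rintro rfl
      rw [map_zero, zero_mul, add_zero, ← mul_assoc] at h
      rcases hirr.isUnit_or_isUnit h with hu | hu
      · exact not_isUnit_of_eval_eq_zero (v := b) (by simp [hABb]) hu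
      · exact not_isUnit_of_eval_eq_zero hCDc hu
  have hABc := habc LAB hAB hAB1 hABa hABb
  have hABd := habd LAB hAB hAB1 hABa hABb
  have hBCa := habc.rotate LBC hBC hBC1 hBCb hBCc
  have hCDa := hacd.rotate LCD hCD hCD1 hCDc hCDd
  have hDAb := habd.rotate.rotate LDA hDA hDA1 hDAd hDAa
  have hDAc := hacd.rotate.rotate LDA hDA hDA1 hDAd hDAa
  have hBCd := hbcd LBC hBC hBC1 hBCb hBCc
  obtain ⟨d₁, d₂, d₃, rfl⟩ := habc.exists_eq_combination d
  obtain ⟨k₁, k₂, k₃, hk⟩ := exists_eval_combination_of_isHomogeneous_two hK a b c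
  have e₁ := eval_combination_of_isHomogeneous_one hAB1 a b c
  have e₂ := eval_combination_of_isHomogeneous_one hBC1 a b c
  have e₃ := eval_combination_of_isHomogeneous_one hCD1 a b c
  have e₄ := eval_combination_of_isHomogeneous_one hDA1 a b c
  simp only [hABa, hABb, hBCb, hBCc, hCDc, hDAa, ha, hb, hc, mul_zero, add_zero, zero_add]
    at e₁ e₂ e₃ e₄ hk
  rw [e₁] at hABd
  rw [e₂] at hBCd
  rw [e₃] at hCDd
  rw [e₄] at hDAd
  rw [hk] at hd
  have hd₃ : d₃ ≠ 0 := left_ne_zero_of_mul hABd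
  have hd₁ : d₁ ≠ 0 := left_ne_zero_of_mul hBCd
  have hd₂ : d₂ ≠ 0 := by
    rintro rfl
    simp_all
  refine ⟨-k₂ * d₂ / (eval c LAB * eval a LCD * d₁), k₁ * d₂ / (eval a LBC * eval b LDA * d₂),
    MvPolynomial.funext fun p => ?_⟩
  obtain ⟨x, y, z, rfl⟩ := habc.exists_eq_combination p
  have hCDb : eval b LCD = -(d₁ * eval a LCD) / d₂ := by
    field_simp; linear_combination hCDd
  have hDAc' : eval c LDA = -(d₂ * eval b LDA) / d₃ := by
    field_simp; linear_combination hDAd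
  have hk₃ : k₃ = -(d₁ * d₂ * k₁ + d₂ * d₃ * k₂) / (d₁ * d₃) := by
    field_simp; linear_combination hd
  simp only [map_add, map_mul, eval_C, hk, e₁, e₂, e₃, e₄, hCDb, hDAc', hk₃]
  field_simp
  ring

/-- Opposite sides of a quadrangle inscribed in an irreducible conic meet off the conic. -/
theorem eval_ne_zero_of_mem_opposite_sides {K : Poly3} (hK : K.IsHomogeneous 2)
    (hirr : Irreducible K)
    {a b c d : Fin 3 → ℂ} (habc : InGeneralPosition a b c) (habd : InGeneralPosition a b d)
    (hacd : InGeneralPosition a c d) (hbcd : InGeneralPosition b c d)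
    (ha : eval a K = 0) (hb : eval b K = 0) (hc : eval c K = 0) (hd : eval d K = 0)
    {LAB LCD : Poly3}
    (hAB : LAB ≠ 0) (hAB1 : LAB.IsHomogeneous 1) (hABa : eval a LAB = 0) (hABb : eval b LAB = 0)
    (hCD : LCD ≠ 0) (hCD1 : LCD.IsHomogeneous 1) (hCDc : eval c LCD = 0) (hCDd : eval d LCD = 0)
    {p : Fin 3 → ℂ} (hp : p ≠ 0) (hABp : eval p LAB = 0) (hCDp : eval p LCD = 0) :
    eval p K ≠ 0 := by
  obtain ⟨LBC, hBC, hBC1, hBCb, hBCc⟩ := exists_line_through b c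
  obtain ⟨LDA, hDA, hDA1, hDAd, hDAa⟩ := exists_line_through d a
  obtain ⟨u, v, -, hv, rfl⟩ := exists_eq_pencil hK hirr habc habd hacd hbcd ha hb hc hd
    hAB hAB1 hABa hABb hBC hBC1 hBCb hBCc hCD hCD1 hCDc hCDd hDA hDA1 hDAd hDAa
  have hABc := habc LAB hAB hAB1 hABa hABb
  have hBCa := habc.rotate LBC hBC hBC1 hBCb hBCc
  have hCDa := hacd.rotate LCD hCD hCD1 hCDc hCDd
  have hCDb := hbcd.rotate LCD hCD hCD1 hCDc hCDd
  have hDAb := habd.rotate.rotate LDA hDA hDA1 hDAd hDAa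
  obtain ⟨x, y, z, rfl⟩ := habc.exists_eq_combination p
  rw [eval_combination_of_isHomogeneous_one hAB1] at hABp
  rw [eval_combination_of_isHomogeneous_one hCD1] at hCDp
  obtain rfl : z = 0 := by simpa [hABa, hABb, hABc] using hABp
  have hx : x ≠ 0 := by
    rintro rfl
    obtain rfl : y = 0 := by simpa [hCDb] using hCDp
    simp at hp
  have hy : y ≠ 0 := by
    rintro rfl
    exact hx (by simpa [hCDa] using hCDp)
  simp only [map_add, map_mul, eval_C, eval_combination_of_isHomogeneous_one hAB1,
    eval_combination_of_isHomogeneous_one hBC1, eval_combination_of_isHomogeneous_one hDA1]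
  simp [hABa, hABb, hBCb, hBCc, hDAa, hv, hx, hy, hBCa, hDAb]

/-- Modulo an irreducible conic, the products of opposite sides of an inscribed quadrangle are
proportional. -/
theorem exists_dvd_sub_of_inscribed {K : Poly3} (hK : K.IsHomogeneous 2) (hirr : Irreducible K)
    {a b c d : Fin 3 → ℂ} (habc : InGeneralPosition a b c) (habd : InGeneralPosition a b d)
    (hacd : InGeneralPosition a c d) (hbcd : InGeneralPosition b c d)
    (ha : eval a K = 0) (hb : eval b K = 0) (hc : eval c K = 0) (hd : eval d K = 0)
    {LAB LBC LCD LDA : Poly3}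
    (hAB : LAB ≠ 0) (hAB1 : LAB.IsHomogeneous 1) (hABa : eval a LAB = 0) (hABb : eval b LAB = 0)
    (hBC : LBC ≠ 0) (hBC1 : LBC.IsHomogeneous 1) (hBCb : eval b LBC = 0) (hBCc : eval c LBC = 0)
    (hCD : LCD ≠ 0) (hCD1 : LCD.IsHomogeneous 1) (hCDc : eval c LCD = 0) (hCDd : eval d LCD = 0)
    (hDA : LDA ≠ 0) (hDA1 : LDA.IsHomogeneous 1) (hDAd : eval d LDA = 0)
    (hDAa : eval a LDA = 0) :
    ∃ r : ℂ, r ≠ 0 ∧ K ∣ LAB * LCD - C r * (LBC * LDA) := by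
  obtain ⟨u, v, hu, hv, h⟩ := exists_eq_pencil hK hirr habc habd hacd hbcd ha hb hc hd
    hAB hAB1 hABa hABb hBC hBC1 hBCb hBCc hCD hCD1 hCDc hCDd hDA hDA1 hDAd hDAa
  refine ⟨-v / u, div_ne_zero (neg_ne_zero.2 hv) hu, C u⁻¹, MvPolynomial.funext fun p => ?_⟩
  rw [h]
  simp only [map_sub, map_add, map_mul, eval_C]
  field_simp
  ring

theorem homogeneousComponent_mul_of_isHomogeneous_left {σ R : Type*} [CommSemiring R]
    {F G : MvPolynomial σ R} {m : ℕ} (hF : F.IsHomogeneous m) (n : ℕ) :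
    homogeneousComponent (m + n) (F * G) = F * homogeneousComponent n G := by
  classical
  let _ : GradedAlgebra (homogeneousSubmodule σ R) := gradedAlgebra
  rw [← decomposition.decompose'_apply, ← decomposition.decompose'_apply]
  exact DirectSum.coe_decompose_mul_add_of_left_mem (homogeneousSubmodule σ R) hF

theorem isHomogeneous_of_mul_left {K W : Poly3} {m n : ℕ} (hK : K.IsHomogeneous m)
    (hK0 : K ≠ 0) (hKW : (K * W).IsHomogeneous (m + n)) : W.IsHomogeneous n := by
  have h := homogeneousComponent_mul_of_isHomogeneous_left (G := W) hK n
  rw [homogeneousComponent_eq_self hKW] at h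
  rw [mul_left_cancel₀ hK0 h]
  exact homogeneousComponent_isHomogeneous n W

/-- **The classical Octagrammum Mysticum.** For an octagon `ABCDEFGH` inscribed in an
irreducible conic, index the lines `l(AB), l(CD), l(EF), l(GH)` by `i : Fin 4` and
`l(BC), l(DE), l(FG), l(HA)` by `j : Fin 4`, and let `M i j` be the intersection point
of the `i`-th line of the first family with the `j`-th line of the second family, all
sixteen intersection points being distinct. Then the eight points
`l(AB)∩l(DE)`, `l(AB)∩l(FG)`, `l(CD)∩l(FG)`, `l(CD)∩l(HA)`, `l(EF)∩l(HA)`,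
`l(EF)∩l(BC)`, `l(GH)∩l(BC)`, `l(GH)∩l(DE)` lie on a common conic. -/
theorem classical_octagrammum_mysticum (A B C D E F G H : ProjPlane)
    (hdist : ([A, B, C, D, E, F, G, H] : List ProjPlane).Pairwise (· ≠ ·))
    (K : Poly3) (hKh : K.IsHomogeneous 2) (hKirr : Irreducible K)
    (honK : ∀ p ∈ [A, B, C, D, E, F, G, H], VanishesAt K p)
    (hn3 : NoThreeCollinear {A, B, C, D, E, F, G, H})
    (lAB lCD lEF lGH lBC lDE lFG lHA : Poly3)
    (hlAB : IsLineThrough lAB A B) (hlCD : IsLineThrough lCD C D)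
    (hlEF : IsLineThrough lEF E F) (hlGH : IsLineThrough lGH G H)
    (hlBC : IsLineThrough lBC B C) (hlDE : IsLineThrough lDE D E)
    (hlFG : IsLineThrough lFG F G) (hlHA : IsLineThrough lHA H A)
    (M : Fin 4 → Fin 4 → ProjPlane)
    (hM1 : ∀ i j, VanishesAt (![lAB, lCD, lEF, lGH] i) (M i j))
    (hM2 : ∀ i j, VanishesAt (![lBC, lDE, lFG, lHA] j) (M i j))
    (hMdist : ∀ i j i' j', M i j = M i' j' → i = i' ∧ j = j') :
    ∃ W : Poly3, W ≠ 0 ∧ W.IsHomogeneous 2 ∧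
      ∀ p ∈ [M 0 1, M 0 2, M 1 2, M 1 3, M 2 3, M 2 0, M 3 0, M 3 1],
        VanishesAt W p := by
  obtain ⟨hAB, hAB1, hABa, hABb⟩ := hlAB
  obtain ⟨hBC, hBC1, hBCb, hBCc⟩ := hlBC
  obtain ⟨hCD, hCD1, hCDc, hCDd⟩ := hlCD
  obtain ⟨hDE, hDE1, hDEd, hDEe⟩ := hlDE
  obtain ⟨hEF, hEF1, hEFe, hEFf⟩ := hlEF
  obtain ⟨hFG, hFG1, hFGf, hFGg⟩ := hlFG
  obtain ⟨hGH, hGH1, hGHg, hGHh⟩ := hlGH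
  obtain ⟨hHA, hHA1, hHAh, hHAa⟩ := hlHA
  have hpos : ∀ i j k : Fin 8, i < j → j < k → InGeneralPosition
      ([A, B, C, D, E, F, G, H].get i).rep ([A, B, C, D, E, F, G, H].get j).rep
      ([A, B, C, D, E, F, G, H].get k).rep := by
    have hne : ∀ i j : Fin 8, i < j →
        [A, B, C, D, E, F, G, H].get i ≠ [A, B, C, D, E, F, G, H].get j :=
      fun i j hij => List.pairwise_iff_get.1 hdist i j hij
    have hmem : ∀ i : Fin 8, [A, B, C, D, E, F, G, H].get i ∈
        ({A, B, C, D, E, F, G, H} : Set ProjPlane) := by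
      intro i
      fin_cases i <;> simp
    intro i j k hij hjk L hL hL1 hi hj hk
    refine hn3 _ _ _ (hmem i) (hmem j) (hmem k) (hne i j hij) (hne i k (hij.trans hjk))
      (hne j k hjk) ⟨L, hL, hL1, ?_⟩
    rintro p (rfl | rfl | rfl) <;> assumption
  have hon : ∀ i : Fin 8, eval ([A, B, C, D, E, F, G, H].get i).rep K = 0 :=
    fun i => honK _ (List.get_mem [A, B, C, D, E, F, G, H] i)
  have ha := hon 0
  have hb := hon 1
  have hc := hon 2
  have hd := hon 3
  have he := hon 4
  have hf := hon 5
  have hg := hon 6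
  have hh := hon 7
  obtain ⟨LAD, hAD, hAD1, hADa, hADd⟩ := exists_line_through A.rep D.rep
  obtain ⟨LAF, hAF, hAF1, hAFa, hAFf⟩ := exists_line_through A.rep F.rep
  obtain ⟨r₁, hr₁, q₁, h₁⟩ := exists_dvd_sub_of_inscribed hKh hKirr
    (hpos 0 1 2 (by decide) (by decide)) (hpos 0 1 3 (by decide) (by decide))
    (hpos 0 2 3 (by decide) (by decide)) (hpos 1 2 3 (by decide) (by decide))
    ha hb hc hd hAB hAB1 hABa hABb hBC hBC1 hBCb hBCc hCD hCD1 hCDc hCDd hAD hAD1 hADd hADa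
  obtain ⟨r₂, hr₂, q₂, h₂⟩ := exists_dvd_sub_of_inscribed hKh hKirr
    (hpos 0 3 4 (by decide) (by decide)) (hpos 0 3 5 (by decide) (by decide))
    (hpos 0 4 5 (by decide) (by decide)) (hpos 3 4 5 (by decide) (by decide))
    ha hd he hf hAD hAD1 hADa hADd hDE hDE1 hDEd hDEe hEF hEF1 hEFe hEFf hAF hAF1 hAFf hAFa
  obtain ⟨r₃, hr₃, q₃, h₃⟩ := exists_dvd_sub_of_inscribed hKh hKirr
    (hpos 0 5 6 (by decide) (by decide)) (hpos 0 5 7 (by decide) (by decide))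
    (hpos 0 6 7 (by decide) (by decide)) (hpos 5 6 7 (by decide) (by decide))
    ha hf hg hh hAF hAF1 hAFa hAFf hFG hFG1 hFGf hFGg hGH hGH1 hGHg hGHh hHA hHA1 hHAh hHAa
  have hprime : Prime K := hKirr.prime
  have hKAD : ¬ K ∣ LAD := fun ⟨q, hq⟩ =>
    (hpos 0 1 3 (by decide) (by decide)).swap.rotate LAD hAD hAD1 hADa hADd
      (by rw [hq, map_mul]; exact mul_eq_zero_of_left hb _)
  have hKAF : ¬ K ∣ LAF := fun ⟨q, hq⟩ =>
    (hpos 0 1 5 (by decide) (by decide)).swap.rotate LAF hAF hAF1 hAFa hAFf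
      (by rw [hq, map_mul]; exact mul_eq_zero_of_left hb _)
  set Q : Poly3 := lAB * lCD * lEF * lGH -
    MvPolynomial.C (r₁ * r₂ * r₃) * (lBC * lDE * lFG * lHA) with hQ
  have hdvd : K ∣ Q * LAD * LAF := by
    refine ⟨q₁ * lEF * lGH * LAD * LAF +
      MvPolynomial.C r₁ * lBC * LAD * (q₂ * lGH * LAF) +
      MvPolynomial.C (r₁ * r₂) * lBC * lDE * LAD * LAF * q₃, ?_⟩
    simp only [hQ, map_mul]
    linear_combination lEF * lGH * LAD * LAF * h₁ +
      MvPolynomial.C r₁ * lBC * LAD * lGH * LAF * h₂ +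
      MvPolynomial.C r₁ * MvPolynomial.C r₂ * lBC * lDE * LAD * LAF * h₃
  obtain ⟨W, hW⟩ : K ∣ Q :=
    (hprime.dvd_or_dvd ((hprime.dvd_or_dvd hdvd).resolve_right hKAF)).resolve_right hKAD
  have hQ4 : Q.IsHomogeneous (2 + 2) :=
    (((hAB1.mul hCD1).mul hEF1).mul hGH1).sub
      ((((hBC1.mul hDE1).mul hFG1).mul hHA1).C_mul _)
  have hQ0 : Q ≠ 0 := by
    intro hQ0
    have hBCa : eval A.rep lBC ≠ 0 :=
      (hpos 0 1 2 (by decide) (by decide)).rotate lBC hBC hBC1 hBCb hBCc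
    have hHAb : eval B.rep lHA ≠ 0 :=
      (hpos 0 1 7 (by decide) (by decide)).rotate.rotate lHA hHA hHA1 hHAh hHAa
    have hDEb : eval B.rep lDE ≠ 0 :=
      (hpos 1 3 4 (by decide) (by decide)).rotate lDE hDE hDE1 hDEd hDEe
    have hFGb : eval B.rep lFG ≠ 0 :=
      (hpos 1 5 6 (by decide) (by decide)).rotate lFG hFG hFG1 hFGf hFGg
    obtain ⟨t, ht⟩ := Infinite.exists_notMem_finset
      ({0, -eval A.rep lDE / eval B.rep lDE, -eval A.rep lFG / eval B.rep lFG} : Finset ℂ)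
    simp only [Finset.mem_insert, Finset.mem_singleton, not_or] at ht
    obtain ⟨ht₀, ht₁, ht₂⟩ := ht
    have key := congrArg (eval ((1 : ℂ) • A.rep + t • B.rep + (0 : ℂ) • B.rep)) hQ0
    simp only [VanishesAt] at hABa hABb hBCb hHAa
    simp only [hQ, map_sub, map_mul, eval_C, map_zero, hABa, hABb, hBCb, hHAa,
      eval_combination_of_isHomogeneous_one hAB1, eval_combination_of_isHomogeneous_one hBC1,
      eval_combination_of_isHomogeneous_one hDE1, eval_combination_of_isHomogeneous_one hFG1,
      eval_combination_of_isHomogeneous_one hHA1] at key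
    have h₁ : eval A.rep lDE + t * eval B.rep lDE ≠ 0 := fun h => ht₁ <| by
      rw [eq_div_iff hDEb]; linear_combination h
    have h₂ : eval A.rep lFG + t * eval B.rep lFG ≠ 0 := fun h => ht₂ <| by
      rw [eq_div_iff hFGb]; linear_combination h
    simp [hr₁, hr₂, hr₃, ht₀, h₁, h₂, hBCa, hHAb] at key
  refine ⟨W, fun h => hQ0 (by rw [hW, h, mul_zero]),
    isHomogeneous_of_mul_left hKh hKirr.ne_zero (hW ▸ hQ4), ?_⟩
  have hWM : ∀ i j, eval (M i j).rep K ≠ 0 → VanishesAt W (M i j) := by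
    intro i j hij
    have h₁ : eval (M i j).rep (lAB * lCD * lEF * lGH) = 0 := by
      have h : eval (M i j).rep (∏ k, ![lAB, lCD, lEF, lGH] k) = 0 := by
        rw [map_prod]
        exact Finset.prod_eq_zero (Finset.mem_univ i) (hM1 i j)
      rwa [Fin.prod_univ_four] at h
    have h₂ : eval (M i j).rep (lBC * lDE * lFG * lHA) = 0 := by
      have h : eval (M i j).rep (∏ k, ![lBC, lDE, lFG, lHA] k) = 0 := by
        rw [map_prod]
        exact Finset.prod_eq_zero (Finset.mem_univ j) (hM2 i j)
      rwa [Fin.prod_univ_four] at h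
    have h := congrArg (eval (M i j).rep) hW
    rw [hQ, map_sub, map_mul (eval _) (MvPolynomial.C _), h₁, h₂, map_mul (eval _) K, mul_zero,
      sub_zero] at h
    exact (mul_eq_zero.1 h.symm).resolve_left hij
  have h01 := hWM 0 1 <| eval_ne_zero_of_mem_opposite_sides hKh hKirr
    (hpos 0 1 3 (by decide) (by decide)) (hpos 0 1 4 (by decide) (by decide))
    (hpos 0 3 4 (by decide) (by decide)) (hpos 1 3 4 (by decide) (by decide))
    ha hb hd he hAB hAB1 hABa hABb hDE hDE1 hDEd hDEe (M 0 1).rep_nonzero (hM1 0 1) (hM2 0 1)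
  have h02 := hWM 0 2 <| eval_ne_zero_of_mem_opposite_sides hKh hKirr
    (hpos 0 1 5 (by decide) (by decide)) (hpos 0 1 6 (by decide) (by decide))
    (hpos 0 5 6 (by decide) (by decide)) (hpos 1 5 6 (by decide) (by decide))
    ha hb hf hg hAB hAB1 hABa hABb hFG hFG1 hFGf hFGg (M 0 2).rep_nonzero (hM1 0 2) (hM2 0 2)
  have h12 := hWM 1 2 <| eval_ne_zero_of_mem_opposite_sides hKh hKirr
    (hpos 2 3 5 (by decide) (by decide)) (hpos 2 3 6 (by decide) (by decide))
    (hpos 2 5 6 (by decide) (by decide)) (hpos 3 5 6 (by decide) (by decide))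
    hc hd hf hg hCD hCD1 hCDc hCDd hFG hFG1 hFGf hFGg (M 1 2).rep_nonzero (hM1 1 2) (hM2 1 2)
  have h13 := hWM 1 3 <| eval_ne_zero_of_mem_opposite_sides hKh hKirr
    (hpos 2 3 7 (by decide) (by decide)) (hpos 0 2 3 (by decide) (by decide)).rotate
    (hpos 0 2 7 (by decide) (by decide)).rotate (hpos 0 3 7 (by decide) (by decide)).rotate
    hc hd hh ha hCD hCD1 hCDc hCDd hHA hHA1 hHAh hHAa (M 1 3).rep_nonzero (hM1 1 3) (hM2 1 3)
  have h23 := hWM 2 3 <| eval_ne_zero_of_mem_opposite_sides hKh hKirr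
    (hpos 4 5 7 (by decide) (by decide)) (hpos 0 4 5 (by decide) (by decide)).rotate
    (hpos 0 4 7 (by decide) (by decide)).rotate (hpos 0 5 7 (by decide) (by decide)).rotate
    he hf hh ha hEF hEF1 hEFe hEFf hHA hHA1 hHAh hHAa (M 2 3).rep_nonzero (hM1 2 3) (hM2 2 3)
  have h20 := hWM 2 0 <| eval_ne_zero_of_mem_opposite_sides hKh hKirr
    (hpos 1 2 4 (by decide) (by decide)) (hpos 1 2 5 (by decide) (by decide))
    (hpos 1 4 5 (by decide) (by decide)) (hpos 2 4 5 (by decide) (by decide))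
    hb hc he hf hBC hBC1 hBCb hBCc hEF hEF1 hEFe hEFf (M 2 0).rep_nonzero (hM2 2 0) (hM1 2 0)
  have h30 := hWM 3 0 <| eval_ne_zero_of_mem_opposite_sides hKh hKirr
    (hpos 1 2 6 (by decide) (by decide)) (hpos 1 2 7 (by decide) (by decide))
    (hpos 1 6 7 (by decide) (by decide)) (hpos 2 6 7 (by decide) (by decide))
    hb hc hg hh hBC hBC1 hBCb hBCc hGH hGH1 hGHg hGHh (M 3 0).rep_nonzero (hM2 3 0) (hM1 3 0)
  have h31 := hWM 3 1 <| eval_ne_zero_of_mem_opposite_sides hKh hKirr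
    (hpos 3 4 6 (by decide) (by decide)) (hpos 3 4 7 (by decide) (by decide))
    (hpos 3 6 7 (by decide) (by decide)) (hpos 4 6 7 (by decide) (by decide))
    hd he hg hh hDE hDE1 hDEd hDEe hGH hGH1 hGHg hGHh (M 3 1).rep_nonzero (hM2 3 1) (hM1 3 1)
  simp only [List.forall_mem_cons, List.not_mem_nil, false_implies, implies_true, and_true]
  exact ⟨h01, h02, h12, h13, h23, h20, h30, h31⟩
end
end

section
/- Let A, B, C, D and E, F, G, H be two quadrilaterals whose eight vertices are distinct points of ℙ²(ℂ) on an irreducible conic, no three collinear, and suppose all sixteen intersection points of a line from {l(AB), l(CD), l(EF), l(GH)} with a line from {l(BC), l(AD), l(FG), l(EH)} are distinct. Then the eight points l(AB) ∩ l(FG), l(AB) ∩ l(EH), l(CD) ∩ l(FG), l(CD) ∩ l(EH), l(EF) ∩ l(BC), l(EF) ∩ l(AD), l(GH) ∩ l(BC), l(GH) ∩ l(AD) lie on a common conic, i.e. some nonzero homogeneous polynomial of degree 2 vanishes at all eight of them. -/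
open MvPolynomial

noncomputable section

/-- Evaluation of a homogeneous polynomial of degree one is linear. -/
lemma exists_linearMap_eval {L : Poly3} (hL : L.IsHomogeneous 1) :
    ∃ f : (Fin 3 → ℂ) →ₗ[ℂ] ℂ, ∀ v, eval v L = f v := by
  have hmem : L ∈ homogeneousSubmodule (Fin 3) ℂ 1 := hL
  rw [homogeneousSubmodule_one_eq_span_X] at hmem
  clear hL
  induction hmem using Submodule.span_induction with
  | mem x hx =>
    obtain ⟨i, rfl⟩ := hx
    exact ⟨LinearMap.proj i, fun v => by simp⟩
  | zero => exact ⟨0, fun v => by simp⟩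
  | add x y _ _ hx hy =>
    obtain ⟨f, hf⟩ := hx
    obtain ⟨g, hg⟩ := hy
    exact ⟨f + g, fun v => by simp [hf, hg]⟩
  | smul c x _ hx =>
    obtain ⟨f, hf⟩ := hx
    exact ⟨c • f, fun v => by simp [hf, smul_eval]⟩

/-- Evaluation of a homogeneous polynomial of degree two is the diagonal of a bilinear map. -/
lemma exists_bilinearMap_eval {Q : Poly3} (hQ : Q.IsHomogeneous 2) :
    ∃ B : (Fin 3 → ℂ) →ₗ[ℂ] (Fin 3 → ℂ) →ₗ[ℂ] ℂ, ∀ v, eval v Q = B v v := by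
  have hmem : Q ∈ homogeneousSubmodule (Fin 3) ℂ 2 := hQ
  rw [← homogeneousSubmodule_one_pow, pow_two] at hmem
  clear hQ
  induction hmem using Submodule.mul_induction_on' with
  | mem_mul_mem p hp q hq =>
    obtain ⟨f, hf⟩ := exists_linearMap_eval hp
    obtain ⟨g, hg⟩ := exists_linearMap_eval hq
    exact ⟨(LinearMap.mul ℂ ℂ).compl₁₂ f g, fun v => by simp [hf, hg]⟩
  | add x _ y _ hx hy =>
    obtain ⟨f, hf⟩ := hx
    obtain ⟨g, hg⟩ := hy
    exact ⟨f + g, fun v => by simp [hf, hg]⟩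

/-- Representatives of three noncollinear points span `ℂ³`. -/
lemma exists_combination_of_not_collin {A B C : ProjPlane} (h : ¬ Collin {A, B, C})
    (v : Fin 3 → ℂ) : ∃ x y z : ℂ, v = x • A.rep + y • B.rep + z • C.rep := by
  set N : Matrix (Fin 3) (Fin 3) ℂ := ![A.rep, B.rep, C.rep] with hN
  have hdet : N.det ≠ 0 := by
    intro h0
    obtain ⟨w, hw, hNw⟩ := Matrix.exists_mulVec_eq_zero_iff.mpr h0
    refine h ⟨∑ i, MvPolynomial.C (w i) * X i, fun hz => hw ?_, ?_, ?_⟩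
    · funext i
      simpa [Pi.single_apply] using congrArg (eval (Pi.single i 1)) hz
    · exact IsHomogeneous.sum _ _ _ fun i _ => isHomogeneous_C_mul_X _ _
    · have key (i : Fin 3) : eval (N i) (∑ i, MvPolynomial.C (w i) * X i) = 0 := by
        simpa [Matrix.mulVec, dotProduct, mul_comm] using congrFun hNw i
      rintro p (rfl | rfl | rfl)
      exacts [key 0, key 1, key 2]
  obtain ⟨c, hc⟩ := Matrix.vecMul_surjective_iff_isUnit.mpr
    ((Matrix.isUnit_iff_isUnit_det N).mpr hdet.isUnit) v
  refine ⟨c 0, c 1, c 2, ?_⟩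
  rw [← hc]
  funext j
  simp [Matrix.vecMul, dotProduct, Fin.sum_univ_three, hN]

/-- A line through two points misses every point not collinear with them. -/
lemma IsLineThrough.eval_ne_zero {L : Poly3} {P Q R : ProjPlane} (h : IsLineThrough L P Q)
    (hR : ¬ Collin {P, Q, R}) : eval R.rep L ≠ 0 := by
  intro h0
  refine hR ⟨L, h.1, h.2.1, ?_⟩
  rintro p (rfl | rfl | rfl)
  exacts [h.2.2.1, h.2.2.2, h0]

/-- A conic through the vertices of a quadrilateral belongs to the pencil spanned by the two
pairs of opposite sides. -/
lemma exists_pencil_coefficients {A B C D : ProjPlane} {K l₁ l₂ l₃ l₄ : Poly3}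
    (hK : K.IsHomogeneous 2) (hA : VanishesAt K A) (hB : VanishesAt K B)
    (hC : VanishesAt K C) (hD : VanishesAt K D)
    (h₁ : IsLineThrough l₁ A B) (h₂ : IsLineThrough l₂ C D)
    (h₃ : IsLineThrough l₃ B C) (h₄ : IsLineThrough l₄ A D)
    (hABC : ¬ Collin {A, B, C}) (hABD : ¬ Collin {A, B, D})
    (hBCA : ¬ Collin {B, C, A}) (hBCD : ¬ Collin {B, C, D})
    (hCDB : ¬ Collin {C, D, B}) (hADB : ¬ Collin {A, D, B}) :
    ∃ u v : ℂ, ∀ w, eval w K = u * (eval w l₁ * eval w l₂) + v * (eval w l₃ * eval w l₄) := by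
  have n1C := h₁.eval_ne_zero hABC
  have n1D := h₁.eval_ne_zero hABD
  have n2B := h₂.eval_ne_zero hCDB
  have n3A := h₃.eval_ne_zero hBCA
  have n3D := h₃.eval_ne_zero hBCD
  have n4B := h₄.eval_ne_zero hADB
  obtain ⟨-, hh₁, z1A, z1B⟩ := h₁
  obtain ⟨-, hh₂, z2C, z2D⟩ := h₂
  obtain ⟨-, hh₃, z3B, z3C⟩ := h₃
  obtain ⟨-, hh₄, z4A, z4D⟩ := h₄
  obtain ⟨f₁, e₁⟩ := exists_linearMap_eval hh₁
  obtain ⟨f₂, e₂⟩ := exists_linearMap_eval hh₂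
  obtain ⟨f₃, e₃⟩ := exists_linearMap_eval hh₃
  obtain ⟨f₄, e₄⟩ := exists_linearMap_eval hh₄
  obtain ⟨b, eK⟩ := exists_bilinearMap_eval hK
  obtain ⟨d₁, d₂, d₃, hd⟩ := exists_combination_of_not_collin hABC D.rep
  simp only [VanishesAt, e₁, e₂, e₃, e₄, eK] at *
  simp only [hd, map_add, map_smul, LinearMap.add_apply, LinearMap.smul_apply, smul_eq_mul,
    hA, hB, hC, z1A, z1B, z2C, z3B, z3C, z4A, mul_zero, add_zero, zero_add] at z2D z4D n1D n3D hD
  have hd₁ : d₁ ≠ 0 := left_ne_zero_of_mul n3D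
  have hd₃ : d₃ ≠ 0 := left_ne_zero_of_mul n1D
  set kAB := b A.rep B.rep + b B.rep A.rep with hkAB
  set kBC := b B.rep C.rep + b C.rep B.rep with hkBC
  set kAC := b A.rep C.rep + b C.rep A.rep with hkAC
  have hD' : d₁ * d₂ * kAB + d₂ * d₃ * kBC + d₁ * d₃ * kAC = 0 := by
    rw [hkAB, hkBC, hkAC]; linear_combination hD
  have hAC : kAC = kBC / (f₁ C.rep * f₂ B.rep) * (f₁ C.rep * f₂ A.rep) +
      kAB / (f₃ A.rep * f₄ B.rep) * (f₃ A.rep * f₄ C.rep) := by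
    field_simp
    apply mul_left_cancel₀ (mul_ne_zero hd₁ hd₃)
    linear_combination f₂ B.rep * f₄ B.rep * hD' - d₃ * kBC * f₄ B.rep * z2D -
      d₁ * kAB * f₂ B.rep * z4D
  refine ⟨kBC / (f₁ C.rep * f₂ B.rep), kAB / (f₃ A.rep * f₄ B.rep), fun w => ?_⟩
  obtain ⟨x, y, z, rfl⟩ := exists_combination_of_not_collin hABC w
  simp only [map_add, map_smul, LinearMap.add_apply, LinearMap.smul_apply, smul_eq_mul,
    hA, hB, hC, z1A, z1B, z2C, z3B, z3C, z4A, mul_zero, add_zero, zero_add]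
  have hBC : kBC = kBC / (f₁ C.rep * f₂ B.rep) * (f₁ C.rep * f₂ B.rep) := by field_simp
  have hAB : kAB = kAB / (f₃ A.rep * f₄ B.rep) * (f₃ A.rep * f₄ B.rep) := by field_simp
  linear_combination x * y * hAB + y * z * hBC + x * z * hAC - x * y * hkAB - y * z * hkBC -
    x * z * hkAC

/-- Two quadrilaterals `ABCD` and `EFGH` inscribed in an irreducible conic: the eight
points `l(AB)∩l(FG)`, `l(AB)∩l(EH)`, `l(CD)∩l(FG)`, `l(CD)∩l(EH)`, `l(EF)∩l(BC)`,
`l(EF)∩l(AD)`, `l(GH)∩l(BC)`, `l(GH)∩l(AD)` lie on a common conic. Here the lines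
`l(AB), l(CD), l(EF), l(GH)` are indexed by `i : Fin 4`, the lines
`l(BC), l(AD), l(FG), l(EH)` by `j : Fin 4`, and `M i j` is the intersection point of
the `i`-th line of the first family with the `j`-th line of the second family, all
sixteen intersection points being distinct. -/
theorem two_quadrilaterals_mystic_conic (A B C D E F G H : ProjPlane)
    (hdist : ([A, B, C, D, E, F, G, H] : List ProjPlane).Pairwise (· ≠ ·))
    (K : Poly3) (hKh : K.IsHomogeneous 2) (hKirr : Irreducible K)
    (honK : ∀ p ∈ [A, B, C, D, E, F, G, H], VanishesAt K p)
    (hn3 : NoThreeCollinear {A, B, C, D, E, F, G, H})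
    (lAB lCD lEF lGH lBC lAD lFG lEH : Poly3)
    (hlAB : IsLineThrough lAB A B) (hlCD : IsLineThrough lCD C D)
    (hlEF : IsLineThrough lEF E F) (hlGH : IsLineThrough lGH G H)
    (hlBC : IsLineThrough lBC B C) (hlAD : IsLineThrough lAD A D)
    (hlFG : IsLineThrough lFG F G) (hlEH : IsLineThrough lEH E H)
    (M : Fin 4 → Fin 4 → ProjPlane)
    (hM1 : ∀ i j, VanishesAt (![lAB, lCD, lEF, lGH] i) (M i j))
    (hM2 : ∀ i j, VanishesAt (![lBC, lAD, lFG, lEH] j) (M i j))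
    (hMdist : ∀ i j i' j', M i j = M i' j' → i = i' ∧ j = j') :
    ∃ W : Poly3, W ≠ 0 ∧ W.IsHomogeneous 2 ∧
      ∀ p ∈ [M 0 2, M 0 3, M 1 2, M 1 3, M 2 0, M 2 1, M 3 0, M 3 1],
        VanishesAt W p := by
  simp only [List.pairwise_cons, List.mem_cons, List.not_mem_nil, or_false, forall_eq_or_imp,
    forall_eq, List.Pairwise.nil, and_true] at hdist honK
  have nc (p q r : ProjPlane) (hp : p ∈ ({A, B, C, D, E, F, G, H} : Set ProjPlane) := by simp)
      (hq : q ∈ ({A, B, C, D, E, F, G, H} : Set ProjPlane) := by simp)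
      (hr : r ∈ ({A, B, C, D, E, F, G, H} : Set ProjPlane) := by simp)
      (h : p ≠ q ∧ p ≠ r ∧ q ≠ r := by grind) : ¬ Collin {p, q, r} :=
    hn3 p q r hp hq hr h.1 h.2.1 h.2.2
  obtain ⟨kA, kB, kC, kD, kE, kF, kG, kH⟩ := honK
  obtain ⟨u, v, huv⟩ := exists_pencil_coefficients hKh kA kB kC kD hlAB hlCD hlBC hlAD
    (nc A B C) (nc A B D) (nc B C A) (nc B C D) (nc C D B) (nc A D B)
  obtain ⟨u', v', huv'⟩ := exists_pencil_coefficients hKh kE kF kG kH hlEF hlGH hlFG hlEH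
    (nc E F G) (nc E F H) (nc F G E) (nc F G H) (nc G H F) (nc E H F)
  have hu : u ≠ 0 := by
    rintro rfl
    have hE := huv E.rep
    rw [show eval E.rep K = 0 from kE] at hE
    have hv : v = 0 := by
      simpa [hlBC.eval_ne_zero (nc B C E), hlAD.eval_ne_zero (nc A D E)] using hE
    exact hKirr.ne_zero (MvPolynomial.funext fun w => by simp [huv w, hv])
  have hF : eval F.rep lFG = 0 := hlFG.2.2.1
  set W : Poly3 := MvPolynomial.C u * (lAB * lCD) - MvPolynomial.C v' * (lFG * lEH) with hW
  have hWeval (w : Fin 3 → ℂ) : eval w W =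
      u * (eval w lAB * eval w lCD) - v' * (eval w lFG * eval w lEH) := by simp [hW]
  have hWeval' (w : Fin 3 → ℂ) : eval w W =
      u' * (eval w lEF * eval w lGH) - v * (eval w lBC * eval w lAD) := by
    rw [hWeval]
    linear_combination huv' w - huv w
  refine ⟨W, fun h0 => ?_, ?_, ?_⟩
  · have h := hWeval F.rep
    rw [h0, hF] at h
    simp [hu, hlAB.eval_ne_zero (nc A B F), hlCD.eval_ne_zero (nc C D F)] at h
  · exact ((hlAB.2.1.mul hlCD.2.1).C_mul u).sub ((hlFG.2.1.mul hlEH.2.1).C_mul v')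
  · have m1 : ∀ i j, eval (M i j).rep (![lAB, lCD, lEF, lGH] i) = 0 := hM1
    have m2 : ∀ i j, eval (M i j).rep (![lBC, lAD, lFG, lEH] j) = 0 := hM2
    simp [Fin.forall_fin_succ] at m1 m2
    simp only [List.mem_cons, List.not_mem_nil, or_false, forall_eq_or_imp, forall_eq, VanishesAt]
    refine ⟨?_, ?_, ?_, ?_, ?_, ?_, ?_, ?_⟩
    iterate 4 rw [hWeval]; simp [m1, m2]
    iterate 4 rw [hWeval']; simp [m1, m2]
end
end
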